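/- arXiv:physics/0508173 — 2 statements merged into one kernel-verified Lean document; each statement's English description precedes it below -/
import Mathlib

section
/- Let α be a real number, let u_s : ℝ³ → ℝ³ be a smooth vector field, and set u = (1−α²Δ)u_s. Then at every point of ℝ³, (∇u_s)ᵀ·u − ∇( ½|u_s|² + (α²/2)|∇u_s|² ) = −α² div( (∇u_s)ᵀ·∇u_s ). -/
open Matrix MeasureTheory

noncomputable section

abbrev V3 := Fin 3 → ℝ

/-- Partial derivative `∂_j f` of a scalar field on ℝ³. -/
def pd (j : Fin 3) (f : V3 → ℝ) (x : V3) : ℝ := fderiv ℝ f x (Pi.single j 1)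

/-- Jacobian matrix field: `(∇f)_{ij} = ∂f_i/∂x_j`. -/
def grad (f : V3 → V3) (x : V3) : Matrix (Fin 3) (Fin 3) ℝ :=
  Matrix.of fun i j => pd j (fun y => f y i) x

/-- Divergence of a vector field. -/
def divV (f : V3 → V3) (x : V3) : ℝ := ∑ j, pd j (fun y => f y j) x

/-- Divergence of a matrix field: `(div M)_i = Σ_j ∂_j M_{ij}`. -/
def divM (M : V3 → Matrix (Fin 3) (Fin 3) ℝ) (x : V3) (i : Fin 3) : ℝ :=
  ∑ j, pd j (fun y => M y i j) x

/-- Scalar Laplacian. -/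
def lapS (φ : V3 → ℝ) (x : V3) : ℝ := ∑ j, pd j (fun y => pd j φ y) x

/-- Componentwise Laplacian of a vector field. -/
def lap (f : V3 → V3) (x : V3) (i : Fin 3) : ℝ := lapS (fun y => f y i) x

/-- Helmholtz operator `(1 - α²Δ)` on vector fields. -/
def helm (α : ℝ) (f : V3 → V3) (x : V3) (i : Fin 3) : ℝ := f x i - α ^ 2 * lap f x i

/-- Helmholtz operator `(1 - α²Δ)` on scalar fields. -/
def helmS (α : ℝ) (φ : V3 → ℝ) (x : V3) : ℝ := φ x - α ^ 2 * lapS φ x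

/-- Advection `(g·∇)f = Σ_j g_j ∂_j f`. -/
def advect (g f : V3 → V3) (x : V3) (i : Fin 3) : ℝ :=
  ∑ j, g x j * pd j (fun y => f y i) x

/-- `(∇f)ᵀ·g`, pointwise matrix-vector product. -/
def gradTvec (f g : V3 → V3) (x : V3) (i : Fin 3) : ℝ :=
  ∑ j, (grad f x)ᵀ i j * g x j

/-- Gradient of a scalar field. -/
def gradS (φ : V3 → ℝ) (x : V3) (i : Fin 3) : ℝ := pd i φ x

/-- Pointwise squared Euclidean norm `|f|²`. -/
def normSq (f : V3 → V3) (x : V3) : ℝ := ∑ i, (f x i) ^ 2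

/-- Squared Frobenius norm of the Jacobian, `|∇f|²`. -/
def gradNormSq (f : V3 → V3) (x : V3) : ℝ := ∑ i, ∑ j, (grad f x i j) ^ 2

/-- Partial derivatives of smooth scalar fields are smooth. -/
theorem contDiff_pd (j : Fin 3) {f : V3 → ℝ} (hf : ContDiff ℝ (⊤ : ℕ∞) f) :
    ContDiff ℝ (⊤ : ℕ∞) (pd j f) :=
  (hf.fderiv_right (m := (⊤ : ℕ∞)) (by simp)).clm_apply contDiff_const

theorem pd_add (j : Fin 3) {f g : V3 → ℝ} {x : V3} (hf : DifferentiableAt ℝ f x)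
    (hg : DifferentiableAt ℝ g x) : pd j (fun y => f y + g y) x = pd j f x + pd j g x := by
  simp [pd, fderiv_fun_add hf hg]

theorem pd_mul (j : Fin 3) {f g : V3 → ℝ} {x : V3} (hf : DifferentiableAt ℝ f x)
    (hg : DifferentiableAt ℝ g x) :
    pd j (fun y => f y * g y) x = f x * pd j g x + g x * pd j f x := by
  simp [pd, fderiv_fun_mul hf hg]

theorem pd_const_mul (j : Fin 3) (c : ℝ) {f : V3 → ℝ} {x : V3} (hf : DifferentiableAt ℝ f x) :
    pd j (fun y => c * f y) x = c * pd j f x := by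
  simp [pd, fderiv_const_mul hf]

theorem pd_sq (j : Fin 3) {f : V3 → ℝ} {x : V3} (hf : DifferentiableAt ℝ f x) :
    pd j (fun y => f y ^ 2) x = 2 * f x * pd j f x := by
  simp only [sq, pd_mul j hf hf]
  ring

theorem pd_sum (j : Fin 3) {F : Fin 3 → V3 → ℝ} {x : V3}
    (hF : ∀ k, DifferentiableAt ℝ (F k) x) :
    pd j (fun y => ∑ k, F k y) x = ∑ k, pd j (F k) x := by
  simp [pd, fderiv_fun_sum fun k _ => hF k]

/-- Symmetry of second partial derivatives. -/
theorem pd_comm (i j : Fin 3) {f : V3 → ℝ} (hf : ContDiff ℝ (⊤ : ℕ∞) f) (x : V3) :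
    pd i (pd j f) x = pd j (pd i f) x := by
  have hd : DifferentiableAt ℝ (fderiv ℝ f) x :=
    (hf.fderiv_right (m := (⊤ : ℕ∞)) (by simp)).differentiable (by simp) x
  have key (a b : Fin 3) :
      pd a (pd b f) x = fderiv ℝ (fderiv ℝ f) x (Pi.single a 1) (Pi.single b 1) := by
    have h := (hd.hasFDerivAt.clm_apply (hasFDerivAt_const (Pi.single b 1 : V3) x)).fderiv
    change fderiv ℝ (fun y => fderiv ℝ f y (Pi.single b 1)) x (Pi.single a 1) = _
    rw [h]
    simp
  rw [key, key]
  exact ((hf.of_le (m := 2) (WithTop.coe_le_coe.2 le_top)).contDiffAt.isSymmSndFDerivAt (by simp)).eq _ _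

/-- the identity `(∇u_s)ᵀ·u − ∇(½|u_s|² + (α²/2)|∇u_s|²) = −α² div((∇u_s)ᵀ·∇u_s)`. -/
theorem gradT_identity_velocity (α : ℝ) (us : V3 → V3) (hus : ContDiff ℝ (⊤ : ℕ∞) us) :
    ∀ x : V3, ∀ i : Fin 3,
      gradTvec us (helm α us) x i
          - gradS (fun y => (1 / 2) * normSq us y + (α ^ 2 / 2) * gradNormSq us y) x i
        = -(α ^ 2) * divM (fun y => (grad us y)ᵀ * grad us y) x i := by
  intro x i
  have hc (j : Fin 3) : ContDiff ℝ (⊤ : ℕ∞) (fun y => us y j) := contDiff_pi.mp hus j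
  have h0 (j : Fin 3) : DifferentiableAt ℝ (fun y => us y j) x :=
    (hc j).differentiable (by simp) x
  have h1 (j k : Fin 3) : DifferentiableAt ℝ (fun y => pd k (fun z => us z j) y) x :=
    (contDiff_pd k (hc j)).differentiable (by simp) x
  have hn : pd i (fun y => ∑ j, us y j ^ 2) x
      = ∑ j, 2 * us x j * pd i (fun y => us y j) x := by
    rw [pd_sum i fun j => (h0 j).fun_pow 2]
    exact Finset.sum_congr rfl fun j _ => pd_sq i (h0 j)
  have hg : pd i (fun y => ∑ j, ∑ k, pd k (fun z => us z j) y ^ 2) x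
      = ∑ j, ∑ k, 2 * pd k (fun z => us z j) x * pd k (pd i fun z => us z j) x := by
    rw [pd_sum i fun j => DifferentiableAt.fun_sum fun k _ => (h1 j k).fun_pow 2]
    refine Finset.sum_congr rfl fun j _ => ?_
    rw [pd_sum i fun k => (h1 j k).fun_pow 2]
    refine Finset.sum_congr rfl fun k _ => ?_
    rw [pd_sq i (h1 j k), ← pd_comm i k (hc j)]
  have hm (k : Fin 3) :
      pd k (fun y => ∑ j, pd i (fun z => us z j) y * pd k (fun z => us z j) y) x
      = ∑ j, (pd i (fun z => us z j) x * pd k (pd k fun z => us z j) x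
          + pd k (fun z => us z j) x * pd k (pd i fun z => us z j) x) := by
    rw [pd_sum k fun j => (h1 j i).fun_mul (h1 j k)]
    exact Finset.sum_congr rfl fun j _ => pd_mul k (h1 j i) (h1 j k)
  have hN : DifferentiableAt ℝ (fun y => ∑ j, us y j ^ 2) x :=
    DifferentiableAt.fun_sum fun j _ => (h0 j).fun_pow 2
  have hG : DifferentiableAt ℝ (fun y => ∑ j, ∑ k, pd k (fun z => us z j) y ^ 2) x :=
    DifferentiableAt.fun_sum fun j _ => DifferentiableAt.fun_sum fun k _ => (h1 j k).fun_pow 2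
  simp only [gradTvec, gradS, divM, normSq, gradNormSq, helm, lap, lapS, grad,
    Matrix.mul_apply, Matrix.transpose_apply, Matrix.of_apply]
  rw [pd_add i (hN.const_mul _) (hG.const_mul _), pd_const_mul i _ hN, pd_const_mul i _ hG,
    hn, hg, Finset.sum_congr rfl fun k _ => hm k]
  simp only [Fin.sum_univ_three]
  ring
end
end

section
/- (Ideal energy conservation for LAMHD-α.) Let u_s, B_s, π solve the LAMHD-α system with ν = η = 0 on an open time interval I, and suppose there is a compact set K ⊂ ℝ³ such that for every t ∈ I the fields u_s(t,·), B_s(t,·) and π(t,·) are supported in K. Then the energy E(t) = ½ ∫_{ℝ³} ( u_s(t,x)·u(t,x) + B_s(t,x)·B(t,x) ) dx is constant on I. -/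
open Matrix MeasureTheory

noncomputable section

/-- Spatial tslice at time `t` of a time-dependent vector field. -/
def tslice (f : ℝ × V3 → V3) (t : ℝ) : V3 → V3 := fun x => f (t, x)

section DirectionalDerivative

variable {E : Type*} [NormedAddCommGroup E] [NormedSpace ℝ E]

/-- Directional derivative of a scalar field along a fixed vector. -/
def dirDeriv (v : E) (f : E → ℝ) (p : E) : ℝ := fderiv ℝ f p v

variable {f g : E → ℝ} {v : E} {p : E}

@[fun_prop]
theorem ContDiff.dirDeriv (hf : ContDiff ℝ (⊤ : ℕ∞) f) (v : E) :
    ContDiff ℝ (⊤ : ℕ∞) (dirDeriv v f) :=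
  (hf.fderiv_right (m := (⊤ : ℕ∞)) le_rfl).clm_apply contDiff_const

theorem ContDiff.differentiableAt_of_smooth (hf : ContDiff ℝ (⊤ : ℕ∞) f) :
    DifferentiableAt ℝ f p :=
  hf.differentiable (by simp) p

theorem dirDeriv_add (hf : ContDiff ℝ (⊤ : ℕ∞) f) (hg : ContDiff ℝ (⊤ : ℕ∞) g) :
    dirDeriv v (fun q => f q + g q) p = dirDeriv v f p + dirDeriv v g p := by
  simp [dirDeriv, fderiv_fun_add hf.differentiableAt_of_smooth hg.differentiableAt_of_smooth]

theorem dirDeriv_sub (hf : ContDiff ℝ (⊤ : ℕ∞) f) (hg : ContDiff ℝ (⊤ : ℕ∞) g) :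
    dirDeriv v (fun q => f q - g q) p = dirDeriv v f p - dirDeriv v g p := by
  simp [dirDeriv, fderiv_fun_sub hf.differentiableAt_of_smooth hg.differentiableAt_of_smooth]

theorem dirDeriv_mul (hf : ContDiff ℝ (⊤ : ℕ∞) f) (hg : ContDiff ℝ (⊤ : ℕ∞) g) :
    dirDeriv v (fun q => f q * g q) p = dirDeriv v f p * g p + f p * dirDeriv v g p := by
  simp [dirDeriv, fderiv_fun_mul hf.differentiableAt_of_smooth hg.differentiableAt_of_smooth]
  ring

theorem dirDeriv_const_mul (c : ℝ) (hf : ContDiff ℝ (⊤ : ℕ∞) f) :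
    dirDeriv v (fun q => c * f q) p = c * dirDeriv v f p := by
  simp [dirDeriv, fderiv_const_mul hf.differentiableAt_of_smooth]

theorem dirDeriv_sum {ι : Type*} [Fintype ι] {F : ι → E → ℝ}
    (hF : ∀ i, ContDiff ℝ (⊤ : ℕ∞) (F i)) :
    dirDeriv v (fun q => ∑ i, F i q) p = ∑ i, dirDeriv v (F i) p := by
  simp [dirDeriv, fderiv_fun_sum fun i _ => (hF i).differentiableAt_of_smooth]

theorem dirDeriv_comm (hf : ContDiff ℝ (⊤ : ℕ∞) f) (v w : E) :
    dirDeriv v (dirDeriv w f) p = dirDeriv w (dirDeriv v f) p := by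
  have hd : DifferentiableAt ℝ (fderiv ℝ f) p :=
    (hf.fderiv_right (m := (⊤ : ℕ∞)) le_rfl).differentiable (by simp) p
  have key (v w : E) : dirDeriv v (dirDeriv w f) p = fderiv ℝ (fderiv ℝ f) p v w := by
    change fderiv ℝ (fun q => fderiv ℝ f q w) p v = _
    rw [fderiv_clm_apply hd (differentiableAt_const w)]
    simp
  rw [key, key]
  exact (hf.contDiffAt.isSymmSndFDerivAt
    (by simpa using WithTop.coe_le_coe.2 (le_top : (2 : ℕ∞) ≤ ⊤))) v w

theorem dirDeriv_eq_zero_of_eventually (h : ∀ᶠ q in nhds p, f q = 0) : dirDeriv v f p = 0 := by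
  have : f =ᶠ[nhds p] fun _ => 0 := h
  simp [dirDeriv, this.fderiv_eq]

end DirectionalDerivative

/-- The unit time direction in spacetime. -/
def timeDir : ℝ × V3 := (1, 0)

/-- The `j`-th unit space direction in spacetime. -/
def spaceDir (j : Fin 3) : ℝ × V3 := (0, Pi.single j 1)

/-- The Helmholtz operator in the space variables, acting on scalar fields on spacetime. -/
def helmST (α : ℝ) (f : ℝ × V3 → ℝ) (p : ℝ × V3) : ℝ :=
  f p - α ^ 2 * ∑ j, dirDeriv (spaceDir j) (dirDeriv (spaceDir j) f) p

section Slices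

variable {f : ℝ × V3 → ℝ}

@[fun_prop]
theorem ContDiff.helmST (hf : ContDiff ℝ (⊤ : ℕ∞) f) (α : ℝ) :
    ContDiff ℝ (⊤ : ℕ∞) (helmST α f) := by
  unfold _root_.helmST
  fun_prop

theorem pd_slice (hf : ContDiff ℝ (⊤ : ℕ∞) f) (j : Fin 3) (t : ℝ) (x : V3) :
    pd j (fun y => f (t, y)) x = dirDeriv (spaceDir j) f (t, x) := by
  have h := (hf.differentiableAt_of_smooth (p := (t, x))).hasFDerivAt.comp x
    (hasFDerivAt_prodMk_right t x)
  have h' : fderiv ℝ (fun y => f (t, y)) x = _ := h.fderiv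
  simp [pd, dirDeriv, spaceDir, h']

theorem hasDerivAt_slice (hf : ContDiff ℝ (⊤ : ℕ∞) f) (t : ℝ) (x : V3) :
    HasDerivAt (fun s => f (s, x)) (dirDeriv timeDir f (t, x)) t := by
  have h := (hf.differentiableAt_of_smooth (p := (t, x))).hasFDerivAt.comp_hasDerivAt t
    ((hasDerivAt_id t).prodMk (hasDerivAt_const t x))
  simpa [dirDeriv, timeDir, Function.comp_def] using h

theorem helm_slice {F : ℝ × V3 → V3} (hF : ContDiff ℝ (⊤ : ℕ∞) F) (α t : ℝ) (x : V3)
    (i : Fin 3) : helm α (tslice F t) x i = helmST α (fun p => F p i) (t, x) := by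
  have hFi : ContDiff ℝ (⊤ : ℕ∞) fun p => F p i := by fun_prop
  have h (j : Fin 3) : (fun y => pd j (fun z => F (t, z) i) y) =
      fun y => dirDeriv (spaceDir j) (fun p => F p i) (t, y) :=
    funext fun y => pd_slice hFi j t y
  simp only [helm, lap, lapS, helmST, tslice, h]
  congr 2
  exact Finset.sum_congr rfl fun j _ => pd_slice (hFi.dirDeriv _) j t x

/-- Green's identity for the Helmholtz operator, in divergence form. -/
theorem helmST_green (hf : ContDiff ℝ (⊤ : ℕ∞) f) (α : ℝ) (p : ℝ × V3) :
    f p * dirDeriv timeDir (helmST α f) p - dirDeriv timeDir f p * helmST α f p =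
      ∑ j, dirDeriv (spaceDir j) (fun q => α ^ 2 *
        (dirDeriv timeDir f q * dirDeriv (spaceDir j) f q
          - f q * dirDeriv (spaceDir j) (dirDeriv timeDir f) q)) p := by
  have hT : dirDeriv timeDir (helmST α f) p = dirDeriv timeDir f p - α ^ 2 *
      ∑ j, dirDeriv (spaceDir j) (dirDeriv (spaceDir j) (dirDeriv timeDir f)) p := by
    have hc (j : Fin 3) : dirDeriv (spaceDir j) (dirDeriv timeDir f) =
        dirDeriv timeDir (dirDeriv (spaceDir j) f) := funext fun q => dirDeriv_comm hf _ _
    change dirDeriv timeDir (fun q => f q - α ^ 2 * ∑ j,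
      dirDeriv (spaceDir j) (dirDeriv (spaceDir j) f) q) p = _
    rw [dirDeriv_sub hf (by fun_prop), dirDeriv_const_mul _ (by fun_prop),
      dirDeriv_sum fun j => by fun_prop]
    simp only [hc]
    congr 2
    exact Finset.sum_congr rfl fun j _ => dirDeriv_comm (hf.dirDeriv _) _ _
  have hD (j : Fin 3) : dirDeriv (spaceDir j) (fun q => α ^ 2 *
        (dirDeriv timeDir f q * dirDeriv (spaceDir j) f q
          - f q * dirDeriv (spaceDir j) (dirDeriv timeDir f) q)) p =
      α ^ 2 * (dirDeriv timeDir f p * dirDeriv (spaceDir j) (dirDeriv (spaceDir j) f) p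
        - f p * dirDeriv (spaceDir j) (dirDeriv (spaceDir j) (dirDeriv timeDir f)) p) := by
    rw [dirDeriv_const_mul _ (by fun_prop), dirDeriv_sub (by fun_prop) (by fun_prop),
      dirDeriv_mul (by fun_prop) (by fun_prop), dirDeriv_mul (by fun_prop) (by fun_prop)]
    ring
  simp only [hT, hD, helmST, Fin.sum_univ_three]
  ring

end Slices

section Integrals

variable {I : Set ℝ} {K : Set V3} {f : ℝ × V3 → ℝ}

theorem dirDeriv_eq_zero_off (hI : IsOpen I) (hK : IsCompact K)
    (h : ∀ t ∈ I, ∀ x ∉ K, f (t, x) = 0) (v : ℝ × V3) :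
    ∀ t ∈ I, ∀ x ∉ K, dirDeriv v f (t, x) = 0 := fun t ht x hx =>
  dirDeriv_eq_zero_of_eventually <| by
    filter_upwards [(hI.prod hK.isClosed.isOpen_compl).mem_nhds (Set.mk_mem_prod ht hx)]
      with q hq using h q.1 hq.1 q.2 hq.2

theorem integrable_slice (hK : IsCompact K) (hf : Continuous f) {t : ℝ}
    (h : ∀ x ∉ K, f (t, x) = 0) : Integrable fun x => f (t, x) :=
  (by fun_prop : Continuous fun x => f (t, x)).integrable_of_hasCompactSupport
    (HasCompactSupport.intro hK h)

theorem integral_dirDeriv_spaceDir_eq_zero (hI : IsOpen I) (hK : IsCompact K)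
    (hf : ContDiff ℝ (⊤ : ℕ∞) f) (h : ∀ t ∈ I, ∀ x ∉ K, f (t, x) = 0) (j : Fin 3)
    {t : ℝ} (ht : t ∈ I) : ∫ x, dirDeriv (spaceDir j) f (t, x) = 0 := by
  have hpd : (fun x => dirDeriv (spaceDir j) f (t, x)) =
      fun x => fderiv ℝ (fun y => f (t, y)) x (Pi.single j 1) :=
    funext fun x => (pd_slice hf j t x).symm
  have hint : Integrable fun x => dirDeriv (spaceDir j) f (t, x) :=
    integrable_slice hK (hf.dirDeriv _).continuous (dirDeriv_eq_zero_off hI hK h _ t ht)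
  have key := integral_mul_fderiv_eq_neg_fderiv_mul_of_integrable (μ := (volume : Measure V3))
    (f := fun y => f (t, y)) (g := fun _ => (1 : ℝ)) (v := Pi.single j 1)
    (by simpa [← hpd] using hint) (by simp)
    (by simpa using integrable_slice hK hf.continuous (h t ht))
    (fun x _ => (by fun_prop : ContDiff ℝ (⊤ : ℕ∞) fun y => f (t, y)).differentiableAt_of_smooth)
    (fun x _ => differentiableAt_const _)
  simp only [mul_one, fderiv_fun_const, Pi.zero_apply, _root_.zero_apply, mul_zero,
    integral_zero, zero_eq_neg] at key
  rw [hpd, key]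

theorem hasDerivAt_integral_slice (hI : IsOpen I) (hK : IsCompact K)
    (hf : ContDiff ℝ (⊤ : ℕ∞) f) (h : ∀ t ∈ I, ∀ x ∉ K, f (t, x) = 0)
    {t : ℝ} (ht : t ∈ I) :
    HasDerivAt (fun s => ∫ x, f (s, x)) (∫ x, dirDeriv timeDir f (t, x)) t := by
  obtain ⟨ε, hε, hball⟩ := Metric.nhds_basis_closedBall.mem_iff.1 (hI.mem_nhds ht)
  have h' := dirDeriv_eq_zero_off hI hK h timeDir
  have hc : Continuous (dirDeriv timeDir f) := (hf.dirDeriv _).continuous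
  obtain ⟨C, hC⟩ := ((isCompact_closedBall t ε).prod hK).exists_bound_of_continuousOn
    hc.continuousOn
  refine (hasDerivAt_integral_of_dominated_loc_of_deriv_le (bound := K.indicator fun _ => C)
    (F' := fun s x => dirDeriv timeDir f (s, x)) (Metric.closedBall_mem_nhds t hε)
    (Filter.Eventually.of_forall fun s => ?_) (integrable_slice hK hf.continuous (h t ht)) ?_
    (Filter.Eventually.of_forall fun x s hs => ?_) ?_
    (Filter.Eventually.of_forall fun x s _ => hasDerivAt_slice hf s x)).2
  · have := hf.continuous
    exact (by fun_prop : Continuous fun x => f (s, x)).aestronglyMeasurable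
  · exact (by fun_prop : Continuous fun x => dirDeriv timeDir f (t, x)).aestronglyMeasurable
  · by_cases hx : x ∈ K
    · simpa [hx] using hC (s, x) ⟨hs, hx⟩
    · simp [hx, h' s (hball hs) x hx]
  · exact (integrable_indicator_iff hK.measurableSet).2
      (integrableOn_const hK.measure_lt_top.ne)

/-- A density obeying a local conservation law with spatially compactly supported flux has
constant integral. -/
theorem integral_slice_eq_of_conservation_law (hI : IsOpen I) (hIc : I.OrdConnected)
    (hK : IsCompact K) (hf : ContDiff ℝ (⊤ : ℕ∞) f) (h : ∀ t ∈ I, ∀ x ∉ K, f (t, x) = 0)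
    {Φ : Fin 3 → ℝ × V3 → ℝ} (hΦ : ∀ j, ContDiff ℝ (⊤ : ℕ∞) (Φ j))
    (hΦK : ∀ j, ∀ t ∈ I, ∀ x ∉ K, Φ j (t, x) = 0)
    (hcons : ∀ t ∈ I, ∀ x,
      dirDeriv timeDir f (t, x) = ∑ j, dirDeriv (spaceDir j) (Φ j) (t, x))
    {t₁ t₂ : ℝ} (h₁ : t₁ ∈ I) (h₂ : t₂ ∈ I) : ∫ x, f (t₁, x) = ∫ x, f (t₂, x) := by
  have hd {t : ℝ} (ht : t ∈ I) : HasDerivAt (fun s => ∫ x, f (s, x)) 0 t := by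
    have hz : ∫ x, dirDeriv timeDir f (t, x) = 0 := by
      simp only [hcons t ht]
      rw [integral_finsetSum _ fun j _ => integrable_slice hK ((hΦ j).dirDeriv _).continuous
        (dirDeriv_eq_zero_off hI hK (hΦK j) _ t ht)]
      exact Finset.sum_eq_zero fun j _ =>
        integral_dirDeriv_spaceDir_eq_zero hI hK (hΦ j) (hΦK j) j ht
    simpa only [hz] using hasDerivAt_integral_slice hI hK hf h ht
  exact hI.is_const_of_deriv_eq_zero hIc.isPreconnected
    (fun t ht => (hd ht).differentiableAt.differentiableWithinAt)
    (fun t ht => (hd ht).deriv) h₁ h₂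

end Integrals

/-- The flux in the local energy balance of ideal LAMHD-α, as a function of the components of
the velocity, the magnetic field, and the pressure. -/
def energyFlux (α : ℝ) (U B : Fin 3 → ℝ × V3 → ℝ) (P : ℝ × V3 → ℝ) (j : Fin 3)
    (p : ℝ × V3) : ℝ :=
  (-2) * (U j p * (∑ i, U i p * helmST α (U i) p + ∑ i, B i p * helmST α (B i) p + P p))
    + 2 * (B j p * ∑ i, U i p * helmST α (B i) p)
    + (∑ i, α ^ 2 * (dirDeriv timeDir (B i) p * dirDeriv (spaceDir j) (B i) p
          - B i p * dirDeriv (spaceDir j) (dirDeriv timeDir (B i)) p)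
      - ∑ i, α ^ 2 * (dirDeriv timeDir (U i) p * dirDeriv (spaceDir j) (U i) p
          - U i p * dirDeriv (spaceDir j) (dirDeriv timeDir (U i)) p))

section EnergyBalance

variable {α : ℝ} {U B : Fin 3 → ℝ × V3 → ℝ} {P : ℝ × V3 → ℝ}

theorem contDiff_energyFlux (hU : ∀ i, ContDiff ℝ (⊤ : ℕ∞) (U i))
    (hB : ∀ i, ContDiff ℝ (⊤ : ℕ∞) (B i)) (hP : ContDiff ℝ (⊤ : ℕ∞) P) (j : Fin 3) :
    ContDiff ℝ (⊤ : ℕ∞) (energyFlux α U B P j) := by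
  unfold energyFlux
  fun_prop

theorem local_energy_balance (hU : ∀ i, ContDiff ℝ (⊤ : ℕ∞) (U i))
    (hB : ∀ i, ContDiff ℝ (⊤ : ℕ∞) (B i)) (hP : ContDiff ℝ (⊤ : ℕ∞) P) (p : ℝ × V3)
    (hdivU : ∑ j, dirDeriv (spaceDir j) (U j) p = 0)
    (hdivB : ∑ j, dirDeriv (spaceDir j) (B j) p = 0)
    (hmotion : ∀ i, dirDeriv timeDir (helmST α (U i)) p
      + ∑ j, U j p * dirDeriv (spaceDir j) (helmST α (U i)) p
      - ∑ j, B j p * dirDeriv (spaceDir j) (helmST α (B i)) p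
      + ∑ j, dirDeriv (spaceDir i) (U j) p * helmST α (U j) p
      + ∑ j, dirDeriv (spaceDir i) (helmST α (B j)) p * B j p
      + dirDeriv (spaceDir i) P p = 0)
    (hinduction : ∀ i, dirDeriv timeDir (B i) p
      + ∑ j, U j p * dirDeriv (spaceDir j) (B i) p
      - ∑ j, B j p * dirDeriv (spaceDir j) (U i) p = 0) :
    dirDeriv timeDir (fun q => ∑ i, U i q * helmST α (U i) q
      + ∑ i, B i q * helmST α (B i) q) p =
      ∑ j, dirDeriv (spaceDir j) (energyFlux α U B P j) p := by
  have hL : dirDeriv timeDir (fun q => ∑ i, U i q * helmST α (U i) q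
      + ∑ i, B i q * helmST α (B i) q) p =
      ∑ i, (dirDeriv timeDir (U i) p * helmST α (U i) p
        + U i p * dirDeriv timeDir (helmST α (U i)) p)
      + ∑ i, (dirDeriv timeDir (B i) p * helmST α (B i) p
        + B i p * dirDeriv timeDir (helmST α (B i)) p) := by
    rw [dirDeriv_add (by fun_prop) (by fun_prop), dirDeriv_sum fun i => by fun_prop,
      dirDeriv_sum fun i => by fun_prop]
    congr 1 <;> exact Finset.sum_congr rfl fun i _ => dirDeriv_mul (by fun_prop) (by fun_prop)
  have hdot (j : Fin 3) {A C : Fin 3 → ℝ × V3 → ℝ} (hA : ∀ i, ContDiff ℝ (⊤ : ℕ∞) (A i))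
      (hC : ∀ i, ContDiff ℝ (⊤ : ℕ∞) (C i)) :
      dirDeriv (spaceDir j) (fun q => ∑ i, A i q * C i q) p =
      ∑ i, (dirDeriv (spaceDir j) (A i) p * C i p + A i p * dirDeriv (spaceDir j) (C i) p) := by
    rw [dirDeriv_sum fun i => by fun_prop]
    exact Finset.sum_congr rfl fun i _ => dirDeriv_mul (by fun_prop) (by fun_prop)
  have hR (j : Fin 3) : dirDeriv (spaceDir j) (energyFlux α U B P j) p =
      (-2) * (dirDeriv (spaceDir j) (U j) p *
          (∑ i, U i p * helmST α (U i) p + ∑ i, B i p * helmST α (B i) p + P p)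
        + U j p * (∑ i, (dirDeriv (spaceDir j) (U i) p * helmST α (U i) p
              + U i p * dirDeriv (spaceDir j) (helmST α (U i)) p)
            + ∑ i, (dirDeriv (spaceDir j) (B i) p * helmST α (B i) p
              + B i p * dirDeriv (spaceDir j) (helmST α (B i)) p)
            + dirDeriv (spaceDir j) P p))
      + 2 * (dirDeriv (spaceDir j) (B j) p * ∑ i, U i p * helmST α (B i) p
        + B j p * ∑ i, (dirDeriv (spaceDir j) (U i) p * helmST α (B i) p
              + U i p * dirDeriv (spaceDir j) (helmST α (B i)) p))
      + (∑ i, dirDeriv (spaceDir j) (fun q => α ^ 2 *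
            (dirDeriv timeDir (B i) q * dirDeriv (spaceDir j) (B i) q
            - B i q * dirDeriv (spaceDir j) (dirDeriv timeDir (B i)) q)) p
        - ∑ i, dirDeriv (spaceDir j) (fun q => α ^ 2 *
            (dirDeriv timeDir (U i) q * dirDeriv (spaceDir j) (U i) q
            - U i q * dirDeriv (spaceDir j) (dirDeriv timeDir (U i)) q)) p) := by
    unfold energyFlux
    rw [dirDeriv_add (by fun_prop) (by fun_prop), dirDeriv_add (by fun_prop) (by fun_prop),
      dirDeriv_sub (by fun_prop) (by fun_prop), dirDeriv_sum fun i => by fun_prop,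
      dirDeriv_sum fun i => by fun_prop, dirDeriv_const_mul _ (by fun_prop),
      dirDeriv_const_mul _ (by fun_prop), dirDeriv_mul (by fun_prop) (by fun_prop),
      dirDeriv_mul (by fun_prop) (by fun_prop), dirDeriv_add (by fun_prop) (by fun_prop),
      dirDeriv_add (by fun_prop) (by fun_prop), hdot j hU (by fun_prop),
      hdot j hB (by fun_prop), hdot j hU (by fun_prop)]
  have hgU i := helmST_green (hU i) α p
  have hgB i := helmST_green (hB i) α p
  rw [hL]
  simp only [hR]
  simp only [Finset.sum_add_distrib, Finset.sum_sub_distrib]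
  rw [Finset.sum_comm (f := fun j i => dirDeriv (spaceDir j) (fun q => α ^ 2 *
            (dirDeriv timeDir (B i) q * dirDeriv (spaceDir j) (B i) q
            - B i q * dirDeriv (spaceDir j) (dirDeriv timeDir (B i)) q)) p),
    Finset.sum_comm (f := fun j i => dirDeriv (spaceDir j) (fun q => α ^ 2 *
            (dirDeriv timeDir (U i) q * dirDeriv (spaceDir j) (U i) q
            - U i q * dirDeriv (spaceDir j) (dirDeriv timeDir (U i)) q)) p)]
  simp only [← hgU, ← hgB]
  simp only [Fin.sum_univ_three] at hdivU hdivB hmotion hinduction ⊢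
  linear_combination 2 * U 0 p * hmotion 0 + 2 * U 1 p * hmotion 1 + 2 * U 2 p * hmotion 2
    + 2 * helmST α (B 0) p * hinduction 0 + 2 * helmST α (B 1) p * hinduction 1
    + 2 * helmST α (B 2) p * hinduction 2
    + 2 * (U 0 p * helmST α (U 0) p + U 1 p * helmST α (U 1) p + U 2 p * helmST α (U 2) p
      + (B 0 p * helmST α (B 0) p + B 1 p * helmST α (B 1) p + B 2 p * helmST α (B 2) p)
      + P p) * hdivU
    - 2 * (U 0 p * helmST α (B 0) p + U 1 p * helmST α (B 1) p + U 2 p * helmST α (B 2) p)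
      * hdivB

end EnergyBalance

/-- ideal energy conservation for LAMHD-α.  For solutions with
`ν = η = 0` on an open interval, supported in a fixed compact set in space, the energy
`E(t) = ½ ∫ (u_s·u + B_s·B) dx` is constant. -/
theorem lamhd_ideal_energy_conservation (α : ℝ) (hα : 0 ≤ α) (I : Set ℝ) (hIopen : IsOpen I) (hIconn : I.OrdConnected)
    (us Bs : ℝ × V3 → V3) (pres : ℝ × V3 → ℝ)
    (hus : ContDiff ℝ (⊤ : ℕ∞) us) (hBs : ContDiff ℝ (⊤ : ℕ∞) Bs) (hpres : ContDiff ℝ (⊤ : ℕ∞) pres)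
    (hdivu : ∀ t ∈ I, ∀ x : V3, divV (tslice us t) x = 0)
    (hdivB : ∀ t ∈ I, ∀ x : V3, divV (tslice Bs t) x = 0)
    (hmotion : ∀ t ∈ I, ∀ x : V3, ∀ i : Fin 3,
      deriv (fun s => helm α (tslice us s) x i) t
        + advect (tslice us t) (helm α (tslice us t)) x i
        - advect (tslice Bs t) (helm α (tslice Bs t)) x i
        + gradTvec (tslice us t) (helm α (tslice us t)) x i
        + gradTvec (helm α (tslice Bs t)) (tslice Bs t) x i
        + gradS (fun y => pres (t, y)) x i = 0)
    (hinduction : ∀ t ∈ I, ∀ x : V3, ∀ i : Fin 3,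
      deriv (fun s => Bs (s, x) i) t
        + advect (tslice us t) (tslice Bs t) x i
        - advect (tslice Bs t) (tslice us t) x i = 0)
    (K : Set V3) (hK : IsCompact K)
    (hsupp : ∀ t ∈ I, ∀ x : V3, x ∉ K →
      us (t, x) = 0 ∧ Bs (t, x) = 0 ∧ pres (t, x) = 0) :
    ∀ t₁ ∈ I, ∀ t₂ ∈ I,
      (1 / 2 : ℝ) * ∫ x : V3, (∑ i, us (t₁, x) i * helm α (tslice us t₁) x i
          + ∑ i, Bs (t₁, x) i * helm α (tslice Bs t₁) x i)
      = (1 / 2 : ℝ) * ∫ x : V3, (∑ i, us (t₂, x) i * helm α (tslice us t₂) x i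
          + ∑ i, Bs (t₂, x) i * helm α (tslice Bs t₂) x i) := by
  intro t₁ h₁ t₂ h₂
  have hU (i : Fin 3) : ContDiff ℝ (⊤ : ℕ∞) fun p => us p i := by fun_prop
  have hB (i : Fin 3) : ContDiff ℝ (⊤ : ℕ∞) fun p => Bs p i := by fun_prop
  have hU0 (i : Fin 3) : ∀ t ∈ I, ∀ x ∉ K, us (t, x) i = 0 := fun t ht x hx => by
    simp [(hsupp t ht x hx).1]
  have hB0 (i : Fin 3) : ∀ t ∈ I, ∀ x ∉ K, Bs (t, x) i = 0 := fun t ht x hx => by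
    simp [(hsupp t ht x hx).2.1]
  have hgradT {F G : ℝ × V3 → V3} (hF : ∀ i, ContDiff ℝ (⊤ : ℕ∞) fun p => F p i)
      (t : ℝ) (x : V3) (i : Fin 3) : gradTvec (tslice F t) (tslice G t) x i =
        ∑ j, dirDeriv (spaceDir i) (fun p => F p j) (t, x) * G (t, x) j :=
    Finset.sum_congr rfl fun j _ => congrArg (· * G (t, x) j) (pd_slice (hF j) i t x)
  have hadv {F G : ℝ × V3 → V3} (hF : ∀ i, ContDiff ℝ (⊤ : ℕ∞) fun p => F p i)
      (t : ℝ) (x : V3) (i : Fin 3) : advect (tslice G t) (tslice F t) x i =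
        ∑ j, G (t, x) j * dirDeriv (spaceDir j) (fun p => F p i) (t, x) :=
    Finset.sum_congr rfl fun j _ => congrArg (G (t, x) j * ·) (pd_slice (hF i) j t x)
  have hdiv {F : ℝ × V3 → V3} (hF : ∀ i, ContDiff ℝ (⊤ : ℕ∞) fun p => F p i)
      (t : ℝ) (x : V3) : divV (tslice F t) x =
        ∑ j, dirDeriv (spaceDir j) (fun p => F p j) (t, x) :=
    Finset.sum_congr rfl fun j _ => pd_slice (hF j) j t x
  have hhelm {F : ℝ × V3 → V3} (hF : ContDiff ℝ (⊤ : ℕ∞) F) (t : ℝ) :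
      helm α (tslice F t) = tslice (fun p i => helmST α (fun q => F q i) p) t :=
    funext fun x => funext fun i => helm_slice hF α t x i
  have hHU (i : Fin 3) := (hU i).helmST α
  have hHB (i : Fin 3) := (hB i).helmST α
  simp only [hhelm hus, hhelm hBs] at hmotion ⊢
  congr 1
  refine integral_slice_eq_of_conservation_law hIopen hIconn hK
    (f := fun q => ∑ i, us q i * helmST α (fun p => us p i) q
      + ∑ i, Bs q i * helmST α (fun p => Bs p i) q) (by fun_prop)
    (fun t ht x hx => by simp [hU0 _ t ht x hx, hB0 _ t ht x hx])
    (contDiff_energyFlux (α := α) hU hB hpres) (fun j t ht x hx => ?_)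
    (fun t ht x => local_energy_balance hU hB hpres (t, x) ?_ ?_ (fun i => ?_) (fun i => ?_))
    h₁ h₂
  · have hTU i := dirDeriv_eq_zero_off (f := fun p => us p i) hIopen hK (hU0 i) timeDir t ht x hx
    have hTB i := dirDeriv_eq_zero_off (f := fun p => Bs p i) hIopen hK (hB0 i) timeDir t ht x hx
    simp [energyFlux, hU0 _ t ht x hx, hB0 _ t ht x hx, hTU, hTB]
  · rw [← hdiv hU, hdivu t ht x]
  · rw [← hdiv hB, hdivB t ht x]
  · have h := hmotion t ht x i
    rw [hadv hHU, hadv hHB, hgradT hU, hgradT hHB] at h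
    rw [← h, ← (hasDerivAt_slice (hHU i) t x).deriv, ← pd_slice hpres]
    rfl
  · have h := hinduction t ht x i
    rw [hadv hB, hadv hU] at h
    rw [← h, ← (hasDerivAt_slice (hB i) t x).deriv]
end
end
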